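/- Let R be an associative unital algebra over ℝ, let q ∈ ℝ, and let x, y, c ∈ R satisfy y·x = 1 − c and c·x = q²·(x·c). Then for every natural number n, yⁿ · xⁿ = ∏_{i=0}^{n−1} (1 − q^{2i}·c), where the product is taken in increasing order of i (all the factors pairwise commute, being polynomials in c). -/

import Mathlib

theorem mul_pow_eq_pow_smul_of_mul_eq_smul {S R : Type*} [CommSemiring S] [Semiring R]
    [Algebra S R] {r : S} {x c : R} (h : c * x = r • (x * c)) (n : ℕ) :
    c * x ^ n = r ^ n • (x ^ n * c) := by
  induction n with
  | zero => simp
  | succ n ih =>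
    rw [pow_succ x, ← mul_assoc, ih, smul_mul_assoc, mul_assoc, h, mul_smul_comm, smul_smul,
      ← pow_succ, mul_assoc]

/-- `SU_q(2)`-type commutation: if `y x = 1 - c` and `c x = q² x c`, then
`yⁿ xⁿ = ∏_{i=0}^{n-1} (1 - q^{2i} c)`, the product in increasing order of `i`. -/
theorem pow_mul_pow_eq_prod {R : Type*} [Ring R] [Algebra ℝ R] (q : ℝ)
    (x y c : R) (h1 : y * x = 1 - c) (h2 : c * x = (q ^ 2) • (x * c)) (n : ℕ) :
    y ^ n * x ^ n
      = ((List.range n).map fun i => 1 - q ^ (2 * i) • c).prod := by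
  induction n with
  | zero => simp
  | succ n ih =>
    have hc := mul_pow_eq_pow_smul_of_mul_eq_smul h2 n
    calc y ^ (n + 1) * x ^ (n + 1) = y ^ n * ((y * x) * x ^ n) := by
          rw [pow_succ y, pow_succ' x]; simp only [mul_assoc]
      _ = y ^ n * x ^ n * (1 - q ^ (2 * n) • c) := by
          rw [h1, sub_mul, one_mul, hc, ← pow_mul, mul_assoc, mul_sub (x ^ n), mul_one, mul_smul_comm]
      _ = _ := by rw [ih, List.prod_range_succ]
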